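/- arXiv:2111.15076 — 4 statements merged into one kernel-verified Lean document; each statement's English description precedes it below -/
import Mathlib

section
/- The function x ↦ (24i·x³ + 40x² − 24i·x − 8)/((x − i)⁶·(x + i)⁴), viewed as a map from ℝ to ℂ, is integrable on ℝ, and its integral over ℝ equals 15π/8. (This is the normal-direction integral arising in case (a)(II) of the boundary-term computation, equations (3.45)–(3.46).) -/
open Complex MeasureTheory

lemma ofReal_sub_ne_zero_of_im_ne_zero {a : ℂ} (ha : a.im ≠ 0) (x : ℝ) : (x : ℂ) - a ≠ 0 := by
  intro h
  apply ha
  simpa using congrArg Complex.im h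

/-- A power of order at least two of a simple pole off the real line is integrable on `ℝ`. -/
lemma integrable_inv_ofReal_sub_pow {a : ℂ} (ha : a.im ≠ 0) (n : ℕ) :
    Integrable (fun x : ℝ => (((x : ℂ) - a) ^ (n + 2))⁻¹) := by
  have hbase : Integrable (fun x : ℝ =>
      (|a.im| ^ n)⁻¹ * ((a.im ^ 2)⁻¹ * (1 + ((x - a.re) / a.im) ^ 2)⁻¹)) :=
    (((integrable_inv_one_add_sq.comp_div ha).comp_sub_right a.re).const_mul _).const_mul _
  have hcont : Continuous (fun x : ℝ => (((x : ℂ) - a) ^ (n + 2))⁻¹) :=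
    Continuous.inv₀ (by fun_prop) fun x => pow_ne_zero _ (ofReal_sub_ne_zero_of_im_ne_zero ha x)
  refine hbase.mono' hcont.aestronglyMeasurable (Filter.Eventually.of_forall fun x => ?_)
  have hsq : ‖(x : ℂ) - a‖ ^ 2 = a.im ^ 2 * (1 + ((x - a.re) / a.im) ^ 2) := by
    rw [Complex.sq_norm, Complex.normSq_apply]
    simp only [sub_re, ofReal_re, sub_im, ofReal_im]
    field_simp
    ring
  have him : |a.im| ≤ ‖(x : ℂ) - a‖ := by
    simpa using Complex.abs_im_le_norm ((x : ℂ) - a)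
  have hpos : 0 < |a.im| := abs_pos.mpr ha
  rw [norm_inv, norm_pow, pow_add, mul_inv, ← mul_inv (a.im ^ 2), ← hsq]
  gcongr

/-- A power of order at least two of a simple pole off the real line integrates to zero on `ℝ`. -/
lemma integral_inv_ofReal_sub_pow {a : ℂ} (ha : a.im ≠ 0) (n : ℕ) :
    ∫ x : ℝ, (((x : ℂ) - a) ^ (n + 2))⁻¹ = 0 := by
  have hderiv (x : ℝ) : HasDerivAt (fun x : ℝ => -((n : ℂ) + 1)⁻¹ * (((x : ℂ) - a) ^ (n + 1))⁻¹)
      (((x : ℂ) - a) ^ (n + 2))⁻¹ x := by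
    have hne := ofReal_sub_ne_zero_of_im_ne_zero ha x
    have hn : (n : ℂ) + 1 ≠ 0 := Nat.cast_add_one_ne_zero n
    have h := (((((hasDerivAt_id x).ofReal_comp).sub_const a).pow (n + 1)).inv
      (pow_ne_zero _ hne)).const_mul (-((n : ℂ) + 1)⁻¹)
    refine h.congr_deriv ?_
    simp only [id, ofReal_one, Nat.add_sub_cancel, Pi.pow_apply]
    push_cast
    field_simp
    ring
  have hlim : Filter.Tendsto (fun x : ℝ => -((n : ℂ) + 1)⁻¹ * (((x : ℂ) - a) ^ (n + 1))⁻¹)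
      (Filter.cocompact ℝ) (nhds 0) := by
    have hsub : Filter.Tendsto (fun x : ℝ => (x : ℂ) - a) (Filter.cocompact ℝ)
        (Filter.cocompact ℂ) :=
      (Homeomorph.subRight a).isClosedEmbedding.tendsto_cocompact.comp
        Complex.isometry_ofReal.isClosedEmbedding.tendsto_cocompact
    have hinv := ((Filter.tendsto_inv₀_cobounded (α := ℂ)).mono_left
      Metric.cobounded_eq_cocompact.ge).comp hsub
    simpa [Function.comp_def] using (hinv.pow (n + 1)).const_mul (-((n : ℂ) + 1)⁻¹)
  simpa using integral_of_hasDerivAt_of_tendsto hderiv (integrable_inv_ofReal_sub_pow ha n)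
    (hlim.mono_left atBot_le_cocompact) (hlim.mono_left atTop_le_cocompact)

lemma partial_fraction_decomposition (x : ℝ) :
    (24 * I * (x : ℂ)^3 + 40 * (x : ℂ)^2 - 24 * I * (x : ℂ) - 8) /
        (((x : ℂ) - I) ^ 6 * ((x : ℂ) + I) ^ 4) =
      15 / 8 * (((1 + x ^ 2)⁻¹ : ℝ) : ℂ) + -I * (((x : ℂ) - I) ^ (3 + 2))⁻¹ +
        -1 / 2 * (((x : ℂ) - I) ^ (0 + 2))⁻¹ + 3 / 2 * (((x : ℂ) - -I) ^ (2 + 2))⁻¹ +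
        -7 / 4 * I * (((x : ℂ) - -I) ^ (1 + 2))⁻¹ + -11 / 8 * (((x : ℂ) - -I) ^ (0 + 2))⁻¹ := by
  have hm : (x : ℂ) - I ≠ 0 := ofReal_sub_ne_zero_of_im_ne_zero (by simp) x
  have hp : (x : ℂ) + I ≠ 0 := by
    simpa using ofReal_sub_ne_zero_of_im_ne_zero (a := -I) (by simp) x
  have hfac : (1 : ℂ) + (x : ℂ) ^ 2 = ((x : ℂ) - I) * ((x : ℂ) + I) := by
    linear_combination I_sq
  have hI : I ^ 2 = -1 := I_sq
  push_cast
  rw [hfac]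
  simp only [sub_neg_eq_add]
  generalize hu : (x : ℂ) - I = u at *
  have hx : (x : ℂ) = u + I := by rw [← hu]; ring
  rw [hx] at hp ⊢
  field_simp
  ring_nf
  have hcube : I ^ 3 = -I := I_pow_three
  simp only [I_pow_eq_pow_mod, Nat.reduceMod, pow_zero, pow_one]
  simp only [hI, hcube]
  ring

theorem stmt_0 :
    MeasureTheory.Integrable
      (fun x : ℝ => (24 * I * (x : ℂ)^3 + 40 * (x : ℂ)^2 - 24 * I * (x : ℂ) - 8) / (((x : ℂ) - I) ^ 6 * ((x : ℂ) + I) ^ 4)) ∧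
    ∫ x : ℝ, (24 * I * (x : ℂ)^3 + 40 * (x : ℂ)^2 - 24 * I * (x : ℂ) - 8) / (((x : ℂ) - I) ^ 6 * ((x : ℂ) + I) ^ 4) = 15 * (Real.pi : ℂ) / 8 := by
  have hI : I.im ≠ 0 := by simp
  have hnI : (-I).im ≠ 0 := by simp
  simp only [partial_fraction_decomposition]
  have h₀ : Integrable (fun x : ℝ => 15 / 8 * (((1 + x ^ 2)⁻¹ : ℝ) : ℂ)) :=
    integrable_inv_one_add_sq.ofReal.const_mul _
  have h₁ := (integrable_inv_ofReal_sub_pow hI 3).const_mul (-I)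
  have h₂ := (integrable_inv_ofReal_sub_pow hI 0).const_mul (-1 / 2)
  have h₃ := (integrable_inv_ofReal_sub_pow hnI 2).const_mul (3 / 2)
  have h₄ := (integrable_inv_ofReal_sub_pow hnI 1).const_mul (-7 / 4 * I)
  have h₅ := (integrable_inv_ofReal_sub_pow hnI 0).const_mul (-11 / 8)
  refine ⟨((((h₀.fun_add h₁).fun_add h₂).fun_add h₃).fun_add h₄).fun_add h₅, ?_⟩
  rw [integral_add ((((h₀.fun_add h₁).fun_add h₂).fun_add h₃).fun_add h₄) h₅,
    integral_add (((h₀.fun_add h₁).fun_add h₂).fun_add h₃) h₄, integral_add ((h₀.fun_add h₁).fun_add h₂) h₃,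
    integral_add (h₀.fun_add h₁) h₂, integral_add h₀ h₁]
  simp only [integral_const_mul, integral_inv_ofReal_sub_pow hI, integral_inv_ofReal_sub_pow hnI]
  rw [integral_complex_ofReal, integral_univ_inv_one_add_sq]
  ring
end

section
/- The function x ↦ (−3x³ + 5i·x² + 3x − i)/((x − i)⁵·(x + i)⁴), viewed as a map from ℝ to ℂ, is integrable on ℝ, and its integral over ℝ equals π/8. (This is the normal-direction integral arising from the trace expression (3.48) in case (a)(II) of the boundary-term computation.) -/
open Complex MeasureTheory

/-- A continuous function times `((1 + x ^ 2) ^ 4)⁻¹` is integrable as soon as the function is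
`O(1 + x ^ 2)`. -/
lemma integrable_div_one_add_sq_pow_four {p : ℝ → ℝ} (hp : Continuous p) {C : ℝ}
    (hC : ∀ x, |p x| ≤ C * (1 + x ^ 2)) :
    Integrable (fun x : ℝ => p x / (1 + x ^ 2) ^ 4) := by
  have hcont : Continuous (fun x : ℝ => p x / (1 + x ^ 2) ^ 4) :=
    hp.div (by fun_prop) fun x => by positivity
  refine (integrable_inv_one_add_sq.const_mul C).mono' hcont.aestronglyMeasurable
    (Filter.Eventually.of_forall fun x => ?_)
  have hu : 1 ≤ 1 + x ^ 2 := by nlinarith [sq_nonneg x]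
  have hu0 : 0 < 1 + x ^ 2 := by positivity
  have hCu : 0 ≤ C * (1 + x ^ 2) := (abs_nonneg _).trans (hC x)
  rw [Real.norm_eq_abs, abs_div, abs_of_pos (pow_pos hu0 4), div_le_iff₀ (pow_pos hu0 4)]
  calc |p x| ≤ C * (1 + x ^ 2) * 1 := by simpa using hC x
    _ ≤ C * (1 + x ^ 2) * (1 + x ^ 2) ^ 2 := by gcongr; exact one_le_pow₀ hu
    _ = C * (1 + x ^ 2)⁻¹ * (1 + x ^ 2) ^ 4 := by field_simp

lemma integrable_one_sub_three_mul_sq_div :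
    Integrable (fun x : ℝ => (1 - 3 * x ^ 2) / (1 + x ^ 2) ^ 4) :=
  integrable_div_one_add_sq_pow_four (p := fun x => 1 - 3 * x ^ 2) (C := 3) (by fun_prop)
    fun x => abs_le.2 ⟨by nlinarith [sq_nonneg x], by nlinarith [sq_nonneg x]⟩

lemma integrable_two_mul_div :
    Integrable (fun x : ℝ => 2 * x / (1 + x ^ 2) ^ 4) :=
  integrable_div_one_add_sq_pow_four (p := fun x => 2 * x) (C := 1) (by fun_prop)
    fun x => abs_le.2 ⟨by nlinarith [sq_nonneg (x + 1)], by nlinarith [sq_nonneg (x - 1)]⟩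

lemma integral_two_mul_div : ∫ x : ℝ, 2 * x / (1 + x ^ 2) ^ 4 = 0 := by
  have h := integral_neg_eq_self (fun x : ℝ => 2 * x / (1 + x ^ 2) ^ 4) volume
  simp only [mul_neg, neg_div, even_two.neg_pow, integral_neg] at h
  linarith

lemma tendsto_div_one_add_sq_cobounded :
    Filter.Tendsto (fun x : ℝ => x / (1 + x ^ 2)) (Bornology.cobounded ℝ) (nhds 0) := by
  refine squeeze_zero_norm (a := fun x : ℝ => ‖x⁻¹‖) (fun x => ?_)
    (tendsto_zero_iff_norm_tendsto_zero.1 Filter.tendsto_inv₀_cobounded)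
  have hu : 0 < 1 + x ^ 2 := by positivity
  rcases eq_or_ne x 0 with rfl | hx
  · simp
  · rw [norm_div, norm_inv, Real.norm_of_nonneg hu.le, div_le_iff₀ hu,
      inv_mul_eq_div, le_div_iff₀ (norm_pos_iff.2 hx), Real.norm_eq_abs, abs_mul_abs_self]
    nlinarith

lemma tendsto_inv_one_add_sq_cobounded :
    Filter.Tendsto (fun x : ℝ => (1 + x ^ 2)⁻¹) (Bornology.cobounded ℝ) (nhds 0) := by
  have h := (Filter.tendsto_inv₀_cobounded (α := ℝ)).mul tendsto_div_one_add_sq_cobounded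
  rw [zero_mul] at h
  refine h.congr' ?_
  filter_upwards [Bornology.eventually_ne_cobounded (0 : ℝ)] with x hx
  field_simp

lemma integral_one_sub_three_mul_sq_div :
    ∫ x : ℝ, (1 - 3 * x ^ 2) / (1 + x ^ 2) ^ 4 = Real.pi / 8 := by
  have hderiv (x : ℝ) : HasDerivAt
      (fun x : ℝ => x / (1 + x ^ 2) *
        (2 / 3 * ((1 + x ^ 2)⁻¹) ^ 2 + 1 / 12 * (1 + x ^ 2)⁻¹ + 1 / 8) + 1 / 8 * Real.arctan x)
      ((1 - 3 * x ^ 2) / (1 + x ^ 2) ^ 4) x := by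
    have hu0 : 1 + x ^ 2 ≠ 0 := by positivity
    have hu : HasDerivAt (fun x : ℝ => 1 + x ^ 2) (2 * x) x := by
      simpa using (hasDerivAt_pow 2 x).const_add 1
    have hi := hu.fun_inv hu0
    refine ((((hasDerivAt_id' x).fun_div hu hu0).fun_mul
      ((((hi.fun_pow 2).const_mul (2 / 3)).fun_add (hi.const_mul (1 / 12))).add_const
        (1 / 8))).fun_add ((Real.hasDerivAt_arctan x).const_mul (1 / 8))).congr_deriv ?_
    push_cast
    field_simp
    ring
  have hinv := tendsto_inv_one_add_sq_cobounded
  have hrat := tendsto_div_one_add_sq_cobounded.mul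
    ((((hinv.pow 2).const_mul (2 / 3)).add (hinv.const_mul (1 / 12))).add_const (1 / 8))
  rw [zero_mul] at hrat
  have htop := (hrat.mono_left IsOrderBornology.atTop_le_cobounded).add
    ((Real.tendsto_arctan_atTop.mono_right nhdsWithin_le_nhds).const_mul (1 / 8))
  have hbot := (hrat.mono_left IsOrderBornology.atBot_le_cobounded).add
    ((Real.tendsto_arctan_atBot.mono_right nhdsWithin_le_nhds).const_mul (1 / 8))
  rw [integral_of_hasDerivAt_of_tendsto hderiv integrable_one_sub_three_mul_sq_div hbot htop]
  ring

lemma integrand_eq_ofReal_add_ofReal_mul_I (x : ℝ) :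
    (-3 * (x : ℂ)^3 + 5 * I * (x : ℂ)^2 + 3 * (x : ℂ) - I) /
        (((x : ℂ) - I) ^ 5 * ((x : ℂ) + I) ^ 4) =
      (((1 - 3 * x ^ 2) / (1 + x ^ 2) ^ 4 : ℝ) : ℂ) +
        ((2 * x / (1 + x ^ 2) ^ 4 : ℝ) : ℂ) * I := by
  have hsub : (x : ℂ) - I ≠ 0 := fun h => by simpa using congrArg Complex.im h
  have hadd : (x : ℂ) + I ≠ 0 := fun h => by simpa using congrArg Complex.im h
  have hfac : 1 + (x : ℂ) ^ 2 = (x - I) * (x + I) := by linear_combination I_sq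
  push_cast
  rw [hfac]
  field_simp
  ring_nf
  simp only [I_sq]
  ring

theorem stmt_1 :
    MeasureTheory.Integrable
      (fun x : ℝ => (-3 * (x : ℂ)^3 + 5 * I * (x : ℂ)^2 + 3 * (x : ℂ) - I) / (((x : ℂ) - I) ^ 5 * ((x : ℂ) + I) ^ 4)) ∧
    ∫ x : ℝ, (-3 * (x : ℂ)^3 + 5 * I * (x : ℂ)^2 + 3 * (x : ℂ) - I) / (((x : ℂ) - I) ^ 5 * ((x : ℂ) + I) ^ 4) = (Real.pi : ℂ) / 8 := by
  simp only [integrand_eq_ofReal_add_ofReal_mul_I]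
  have hre : Integrable fun x : ℝ => (((1 - 3 * x ^ 2) / (1 + x ^ 2) ^ 4 : ℝ) : ℂ) :=
    integrable_one_sub_three_mul_sq_div.ofReal
  have him : Integrable fun x : ℝ => ((2 * x / (1 + x ^ 2) ^ 4 : ℝ) : ℂ) * I :=
    integrable_two_mul_div.ofReal.mul_const I
  refine ⟨hre.add him, ?_⟩
  rw [integral_add hre him, integral_mul_const, integral_complex_ofReal, integral_complex_ofReal]
  rw [integral_two_mul_div, integral_one_sub_three_mul_sq_div]
  simp
end

section
/- The function x ↦ (−8i·x² − 32x + 8i)/((x − i)⁵·(x + i)⁴), viewed as a map from ℝ to ℂ, is integrable on ℝ, and its integral over ℝ equals −25π/8. (This is the normal-direction integral arising from the trace expression (3.54) in case (a)(III), yielding the coefficient 25/16·π·h'(0) in (3.56).) -/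
open Complex MeasureTheory

open Filter Topology in
lemma tendsto_inv_one_add_sq_zero {l : Filter ℝ} (hl : Tendsto (fun x : ℝ => x ^ 2) l atTop) :
    Tendsto (fun x : ℝ => (1 + x ^ 2)⁻¹) l (𝓝 0) :=
  tendsto_inv_atTop_zero.comp (tendsto_atTop_add_const_left _ _ hl)

open Filter Topology in
lemma tendsto_mul_inv_one_add_sq_zero {l : Filter ℝ}
    (hl : Tendsto (fun x : ℝ => x ^ 2) l atTop) (hinv : Tendsto (fun x : ℝ => x⁻¹) l (𝓝 0)) :
    Tendsto (fun x : ℝ => x * (1 + x ^ 2)⁻¹) l (𝓝 0) := by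
  have h := hinv.mul ((tendsto_inv_one_add_sq_zero hl).const_sub 1)
  rw [zero_mul] at h
  refine h.congr fun x => ?_
  have hx : 1 + x ^ 2 ≠ 0 := by positivity
  rcases eq_or_ne x 0 with rfl | h0
  · simp
  · field_simp
    ring

lemma hasDerivAt_inv_one_add_sq (x : ℝ) :
    HasDerivAt (fun x : ℝ => (1 + x ^ 2)⁻¹) (-2 * x * (1 + x ^ 2)⁻¹ ^ 2) x := by
  have hx : 1 + x ^ 2 ≠ 0 := by positivity
  refine ((hasDerivAt_pow 2 x).const_add 1).inv hx |>.congr_deriv ?_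
  field_simp
  norm_num [mul_comm]

/-- The real part of an antiderivative of the integrand. -/
noncomputable def antiderivRe (x : ℝ) : ℝ :=
  x * (1 + x ^ 2)⁻¹ * (2 * (1 + x ^ 2)⁻¹ ^ 3 - 5 / 3 * (1 + x ^ 2)⁻¹ ^ 2
    - 25 / 12 * (1 + x ^ 2)⁻¹ - 25 / 8) - 25 / 8 * Real.arctan x

/-- The imaginary part of an antiderivative of the integrand. -/
noncomputable def antiderivIm (x : ℝ) : ℝ :=
  4 / 3 * (1 + x ^ 2)⁻¹ ^ 3 + 2 * (1 + x ^ 2)⁻¹ ^ 4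

lemma hasDerivAt_antiderivRe (x : ℝ) :
    HasDerivAt antiderivRe (16 * (1 + x ^ 2)⁻¹ ^ 5 - 24 * (1 + x ^ 2)⁻¹ ^ 4) x := by
  have hx : 1 + x ^ 2 ≠ 0 := by positivity
  have hv := hasDerivAt_inv_one_add_sq x
  have hpoly := ((((hv.pow 3).const_mul 2).sub ((hv.pow 2).const_mul (5 / 3))).sub
    (hv.const_mul (25 / 12))).sub_const (25 / 8)
  have h := (((hasDerivAt_id x).mul hv).mul hpoly).sub
    ((Real.hasDerivAt_arctan x).const_mul (25 / 8))
  refine h.congr_deriv ?_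
  simp
  field_simp
  ring

lemma hasDerivAt_antiderivIm (x : ℝ) :
    HasDerivAt antiderivIm (-(x * (8 * (1 + x ^ 2)⁻¹ ^ 4 + 16 * (1 + x ^ 2)⁻¹ ^ 5))) x := by
  have hx : 1 + x ^ 2 ≠ 0 := by positivity
  have hv := hasDerivAt_inv_one_add_sq x
  refine (((hv.pow 3).const_mul (4 / 3)).add ((hv.pow 4).const_mul 2)).congr_deriv ?_
  simp
  field_simp
  ring

open Filter Topology in
lemma tendsto_antiderivRe {l : Filter ℝ} {a : ℝ} (hl : Tendsto (fun x : ℝ => x ^ 2) l atTop)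
    (hinv : Tendsto (fun x : ℝ => x⁻¹) l (𝓝 0)) (ha : Tendsto Real.arctan l (𝓝 a)) :
    Tendsto antiderivRe l (𝓝 (-(25 / 8 * a))) := by
  have hv := tendsto_inv_one_add_sq_zero hl
  have hw := tendsto_mul_inv_one_add_sq_zero hl hinv
  have hpoly := ((((hv.pow 3).const_mul 2).sub ((hv.pow 2).const_mul (5 / 3))).sub
    (hv.const_mul (25 / 12))).sub_const (25 / 8)
  simpa [funext antiderivRe.eq_1] using (hw.mul hpoly).sub (ha.const_mul (25 / 8))

open Filter Topology in
lemma tendsto_antiderivIm {l : Filter ℝ} (hl : Tendsto (fun x : ℝ => x ^ 2) l atTop) :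
    Tendsto antiderivIm l (𝓝 0) := by
  have hv := tendsto_inv_one_add_sq_zero hl
  simpa [funext antiderivIm.eq_1] using ((hv.pow 3).const_mul (4 / 3)).add ((hv.pow 4).const_mul 2)

lemma integrand_eq (x : ℝ) :
    (-8 * I * (x : ℂ) ^ 2 - 32 * (x : ℂ) + 8 * I) / (((x : ℂ) - I) ^ 5 * ((x : ℂ) + I) ^ 4) =
      ((16 * (1 + x ^ 2)⁻¹ ^ 5 - 24 * (1 + x ^ 2)⁻¹ ^ 4 : ℝ) : ℂ) +
        ((-(x * (8 * (1 + x ^ 2)⁻¹ ^ 4 + 16 * (1 + x ^ 2)⁻¹ ^ 5)) : ℝ) : ℂ) * I := by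
  have hm : (x : ℂ) - I ≠ 0 := fun h => by simpa using congrArg Complex.im h
  have hp : (x : ℂ) + I ≠ 0 := fun h => by simpa using congrArg Complex.im h
  have hu : (1 + (x : ℂ) ^ 2) = (x - I) * (x + I) := by linear_combination I_sq
  push_cast
  rw [hu]
  field_simp
  ring_nf
  simp only [I_sq, I_pow_three]
  ring

lemma continuous_inv_one_add_sq : Continuous fun x : ℝ => (1 + x ^ 2)⁻¹ :=
  Continuous.inv₀ (by fun_prop) fun x => by positivity

lemma integrable_inv_one_add_sq_pow {n : ℕ} (hn : n ≠ 0) :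
    Integrable fun x : ℝ => (1 + x ^ 2)⁻¹ ^ n := by
  refine integrable_inv_one_add_sq.mono' (continuous_inv_one_add_sq.pow n).aestronglyMeasurable
    (Filter.Eventually.of_forall fun x => ?_)
  have h0 : 0 ≤ (1 + x ^ 2)⁻¹ := by positivity
  rw [Real.norm_of_nonneg (by positivity)]
  exact pow_le_of_le_one h0 (inv_le_one_of_one_le₀ (by nlinarith)) hn

lemma integrable_mul_inv_one_add_sq_pow {n : ℕ} (hn : 2 ≤ n) :
    Integrable fun x : ℝ => x * (1 + x ^ 2)⁻¹ ^ n := by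
  obtain ⟨m, rfl⟩ : ∃ m, n = m + 1 := ⟨n - 1, by omega⟩
  refine (integrable_inv_one_add_sq_pow (n := m) (by omega)).mono'
    (continuous_id.mul (continuous_inv_one_add_sq.pow _)).aestronglyMeasurable
    (Filter.Eventually.of_forall fun x => ?_)
  have hm : 0 ≤ (1 + x ^ 2)⁻¹ ^ m := by positivity
  have hxv : |x * (1 + x ^ 2)⁻¹| ≤ 1 := by
    rw [← div_eq_mul_inv, abs_div, abs_of_pos (by positivity : 0 < 1 + x ^ 2),
      div_le_one (by positivity), abs_le]
    constructor <;> nlinarith [sq_nonneg (x - 1), sq_nonneg (x + 1)]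
  calc ‖x * (1 + x ^ 2)⁻¹ ^ (m + 1)‖ = |x * (1 + x ^ 2)⁻¹| * (1 + x ^ 2)⁻¹ ^ m := by
        rw [pow_succ', ← mul_assoc, Real.norm_eq_abs, abs_mul, abs_of_nonneg hm]
    _ ≤ (1 + x ^ 2)⁻¹ ^ m := mul_le_of_le_one_left hm hxv

lemma integrable_integrand :
    Integrable (fun x : ℝ => (-8 * I * (x : ℂ) ^ 2 - 32 * (x : ℂ) + 8 * I) /
      (((x : ℂ) - I) ^ 5 * ((x : ℂ) + I) ^ 4)) := by
  simp_rw [integrand_eq]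
  have hre : Integrable fun x : ℝ => 16 * (1 + x ^ 2)⁻¹ ^ 5 - 24 * (1 + x ^ 2)⁻¹ ^ 4 :=
    ((integrable_inv_one_add_sq_pow (by norm_num)).const_mul 16).sub
      ((integrable_inv_one_add_sq_pow (by norm_num)).const_mul 24)
  have him : Integrable fun x : ℝ =>
      -(x * (8 * (1 + x ^ 2)⁻¹ ^ 4 + 16 * (1 + x ^ 2)⁻¹ ^ 5)) := by
    refine (((integrable_mul_inv_one_add_sq_pow (n := 4) (by norm_num)).const_mul 8).add
      ((integrable_mul_inv_one_add_sq_pow (n := 5) (by norm_num)).const_mul 16)).neg.congr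
      (Filter.Eventually.of_forall fun x => ?_)
    simp only [Pi.neg_apply, Pi.add_apply]
    ring
  exact hre.ofReal.add (him.ofReal.mul_const I)

open Filter Topology in
lemma tendsto_antideriv {l : Filter ℝ} {a : ℝ} (hl : Tendsto (fun x : ℝ => x ^ 2) l atTop)
    (hinv : Tendsto (fun x : ℝ => x⁻¹) l (𝓝 0)) (ha : Tendsto Real.arctan l (𝓝 a)) :
    Tendsto (fun x : ℝ => (antiderivRe x : ℂ) + (antiderivIm x : ℂ) * I) l
      (𝓝 (((-(25 / 8 * a) : ℝ) : ℂ) + ((0 : ℝ) : ℂ) * I)) :=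
  ((continuous_ofReal.tendsto _).comp (tendsto_antiderivRe hl hinv ha)).add
    (((continuous_ofReal.tendsto _).comp (tendsto_antiderivIm hl)).mul_const I)

theorem stmt_2 :
    MeasureTheory.Integrable
      (fun x : ℝ => (-8 * I * (x : ℂ)^2 - 32 * (x : ℂ) + 8 * I) / (((x : ℂ) - I) ^ 5 * ((x : ℂ) + I) ^ 4)) ∧
    ∫ x : ℝ, (-8 * I * (x : ℂ)^2 - 32 * (x : ℂ) + 8 * I) / (((x : ℂ) - I) ^ 5 * ((x : ℂ) + I) ^ 4) = -(25 * (Real.pi : ℂ) / 8) := by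
  refine ⟨integrable_integrand, ?_⟩
  have hderiv (x : ℝ) : HasDerivAt (fun x : ℝ => (antiderivRe x : ℂ) + (antiderivIm x : ℂ) * I)
      ((-8 * I * (x : ℂ) ^ 2 - 32 * (x : ℂ) + 8 * I) /
        (((x : ℂ) - I) ^ 5 * ((x : ℂ) + I) ^ 4)) x := by
    rw [integrand_eq]
    exact (hasDerivAt_antiderivRe x).ofReal_comp.add
      ((hasDerivAt_antiderivIm x).ofReal_comp.mul_const I)
  have htop := tendsto_antideriv (Filter.tendsto_pow_atTop two_ne_zero) tendsto_inv_atTop_zero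
    (tendsto_nhds_of_tendsto_nhdsWithin Real.tendsto_arctan_atTop)
  have hsq : Filter.Tendsto (fun x : ℝ => x ^ 2) Filter.atBot Filter.atTop := by
    simpa [Function.comp_def] using
      (Filter.tendsto_pow_atTop (α := ℝ) two_ne_zero).comp Filter.tendsto_neg_atBot_atTop
  have hbot := tendsto_antideriv hsq
    tendsto_inv_atBot_zero (tendsto_nhds_of_tendsto_nhdsWithin Real.tendsto_arctan_atBot)
  rw [integral_of_hasDerivAt_of_tendsto hderiv integrable_integrand hbot htop]
  push_cast
  ring
end

section
/- The function x ↦ (−3x² + 4i·x + 1)/((x − i)⁵·(x + i)³), viewed as a map from ℝ to ℂ, is integrable on ℝ, and its integral over ℝ equals −π/2. (This is the normal-direction integral arising from the trace expression (3.55) in case (a)(III) of the boundary-term computation.) -/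
open Complex MeasureTheory

open Filter Topology

lemma ofReal_sub_I_ne_zero (x : ℝ) : (x : ℂ) - I ≠ 0 := fun h => by
  simpa using congrArg im h

lemma ofReal_add_I_ne_zero (x : ℝ) : (x : ℂ) + I ≠ 0 := fun h => by
  simpa using congrArg im h

lemma ofReal_one_add_sq_inv (x : ℝ) :
    (((1 + x ^ 2)⁻¹ : ℝ) : ℂ) = ((x : ℂ) - I)⁻¹ * ((x : ℂ) + I)⁻¹ := by
  rw [← mul_inv]
  push_cast
  congr 1
  linear_combination I_sq

/-- Up to a multiple of `(1 + x ^ 2)⁻¹`, the integrand has a rational primitive. -/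
lemma hasDerivAt_rational_primitive (x : ℝ) :
    HasDerivAt (fun x : ℝ => ((x : ℂ) - I)⁻¹ ^ 3 * ((x : ℂ) + I)⁻¹ ^ 2 / 3
        - (((x : ℂ) - I)⁻¹ + ((x : ℂ) + I)⁻¹) * (((x : ℂ) - I)⁻¹ * ((x : ℂ) + I)⁻¹) / 6
        - (((x : ℂ) - I)⁻¹ + ((x : ℂ) + I)⁻¹) / 4)
      ((-3 * (x : ℂ) ^ 2 + 4 * I * (x : ℂ) + 1) / (((x : ℂ) - I) ^ 5 * ((x : ℂ) + I) ^ 3)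
        + 1 / 2 * (((1 + x ^ 2)⁻¹ : ℝ) : ℂ)) x := by
  have ht := ofReal_sub_I_ne_zero x
  have hu := ofReal_add_I_ne_zero x
  have hp := ((hasDerivAt_id x).ofReal_comp.sub_const I).fun_inv ht
  have hq := ((hasDerivAt_id x).ofReal_comp.add_const I).fun_inv hu
  simp only [id] at hp hq
  refine (((((hp.fun_pow 3).fun_mul (hq.fun_pow 2)).div_const 3).fun_sub
    (((hp.fun_add hq).fun_mul (hp.fun_mul hq)).div_const 6)).fun_sub
    ((hp.fun_add hq).div_const 4)).congr_deriv ?_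
  rw [ofReal_one_add_sq_inv]
  have hf : (-3 * (x : ℂ) ^ 2 + 4 * I * (x : ℂ) + 1) / (((x : ℂ) - I) ^ 5 * ((x : ℂ) + I) ^ 3)
      = -(2 * ((x : ℂ) - I)⁻¹ ^ 3 * ((x : ℂ) + I)⁻¹ ^ 3
        + ((x : ℂ) - I)⁻¹ ^ 4 * ((x : ℂ) + I)⁻¹ ^ 2) := by
    field_simp
    linear_combination I_sq
  have hrel : (((x : ℂ) - I)⁻¹ - ((x : ℂ) + I)⁻¹) ^ 2
      = -4 * (((x : ℂ) - I)⁻¹ * ((x : ℂ) + I)⁻¹) ^ 2 := by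
    field_simp
    linear_combination 4 * I_sq
  rw [hf]
  simp only [div_eq_mul_inv, ← inv_pow, ofReal_one]
  linear_combination
    (((x : ℂ) - I)⁻¹ * ((x : ℂ) + I)⁻¹ / 3 + 1 / 4) * hrel

lemma tendsto_rational_primitive {l : Filter ℝ} (hl : l ≤ Bornology.cobounded ℝ) :
    Tendsto (fun x : ℝ => ((x : ℂ) - I)⁻¹ ^ 3 * ((x : ℂ) + I)⁻¹ ^ 2 / 3
        - (((x : ℂ) - I)⁻¹ + ((x : ℂ) + I)⁻¹) * (((x : ℂ) - I)⁻¹ * ((x : ℂ) + I)⁻¹) / 6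
        - (((x : ℂ) - I)⁻¹ + ((x : ℂ) + I)⁻¹) / 4) l (𝓝 0) := by
  have hx : Tendsto (fun x : ℝ => (x : ℂ)) l (Bornology.cobounded ℂ) := by
    rw [← tendsto_norm_atTop_iff_cobounded]
    simpa only [norm_real] using (tendsto_norm_cobounded_atTop (E := ℝ)).mono_left hl
  have hp : Tendsto (fun x : ℝ => ((x : ℂ) - I)⁻¹) l (𝓝 0) :=
    tendsto_inv₀_cobounded.comp ((tendsto_sub_const_cobounded I).comp hx)
  have hq : Tendsto (fun x : ℝ => ((x : ℂ) + I)⁻¹) l (𝓝 0) :=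
    tendsto_inv₀_cobounded.comp ((tendsto_add_const_cobounded I).comp hx)
  simpa using ((((hp.pow 3).mul (hq.pow 2)).div_const 3).sub
    (((hp.add hq).mul (hp.mul hq)).div_const 6)).sub ((hp.add hq).div_const 4)

lemma integrable_rational_integrand :
    Integrable (fun x : ℝ => (-3 * (x : ℂ) ^ 2 + 4 * I * (x : ℂ) + 1) /
      (((x : ℂ) - I) ^ 5 * ((x : ℂ) + I) ^ 3)) := by
  refine (integrable_inv_one_add_sq.const_mul 8).mono' ?_ (.of_forall fun x => ?_)
  · refine (Continuous.div (by fun_prop) (by fun_prop) fun x => ?_).aestronglyMeasurable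
    exact mul_ne_zero (pow_ne_zero _ (ofReal_sub_I_ne_zero x))
      (pow_ne_zero _ (ofReal_add_I_ne_zero x))
  · have hs : 0 ≤ x ^ 2 := sq_nonneg x
    have ht : ‖(x : ℂ) - I‖ ^ 2 = 1 + x ^ 2 := by
      rw [Complex.sq_norm, normSq_apply]; simp; ring
    have hu : ‖(x : ℂ) + I‖ ^ 2 = 1 + x ^ 2 := by
      rw [Complex.sq_norm, normSq_apply]; simp; ring
    have htu : ‖(x : ℂ) - I‖ = ‖(x : ℂ) + I‖ :=
      (sq_eq_sq₀ (norm_nonneg _) (norm_nonneg _)).1 (ht.trans hu.symm)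
    have hnum : ‖-3 * (x : ℂ) ^ 2 + 4 * I * (x : ℂ) + 1‖ ≤ 8 * (1 + x ^ 2) := by
      calc _ ≤ ‖-3 * (x : ℂ) ^ 2‖ + ‖4 * I * (x : ℂ)‖ + ‖(1 : ℂ)‖ := norm_add₃_le
        _ = 3 * |x| ^ 2 + 4 * |x| + 1 := by simp
        _ ≤ 8 * (1 + |x| ^ 2) := by nlinarith [sq_nonneg (|x| - 1)]
        _ = _ := by rw [sq_abs]
    have hden : ‖((x : ℂ) - I) ^ 5 * ((x : ℂ) + I) ^ 3‖ = (1 + x ^ 2) ^ 4 := by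
      rw [norm_mul, norm_pow, norm_pow, htu, ← hu]; ring
    rw [norm_div, hden, div_le_iff₀ (by positivity)]
    calc _ ≤ 8 * (1 + x ^ 2) := hnum
      _ ≤ 8 * (1 + x ^ 2) ^ 3 := by
        gcongr
        exact le_self_pow₀ (by linarith) (by norm_num)
      _ = _ := by field_simp

theorem stmt_3 :
    MeasureTheory.Integrable
      (fun x : ℝ => (-3 * (x : ℂ)^2 + 4 * I * (x : ℂ) + 1) / (((x : ℂ) - I) ^ 5 * ((x : ℂ) + I) ^ 3)) ∧
    ∫ x : ℝ, (-3 * (x : ℂ)^2 + 4 * I * (x : ℂ) + 1) / (((x : ℂ) - I) ^ 5 * ((x : ℂ) + I) ^ 3) = -((Real.pi : ℂ) / 2) := by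
  refine ⟨integrable_rational_integrand, ?_⟩
  have hint : Integrable fun x : ℝ => 1 / 2 * (((1 + x ^ 2)⁻¹ : ℝ) : ℂ) :=
    integrable_inv_one_add_sq.ofReal.const_mul _
  have h := integral_of_hasDerivAt_of_tendsto hasDerivAt_rational_primitive
    (integrable_rational_integrand.add hint)
    (tendsto_rational_primitive IsOrderBornology.atBot_le_cobounded)
    (tendsto_rational_primitive IsOrderBornology.atTop_le_cobounded)
  rw [integral_add integrable_rational_integrand hint, integral_const_mul, integral_complex_ofReal,
    integral_univ_inv_one_add_sq] at h
  linear_combination h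
end
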